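/- For every ε > 0 there exists r₀ such that for all integers r ≥ r₀, m(3, r) ≥ (4/e² − ε) · r³; equivalently, liminf over r → ∞ of m(3, r)/r³ is at least 4/e². -/

import Mathlib

/-- `minNonColorable n r` is the minimal number of edges in an `n`-uniform hypergraph
that admits no proper `r`-coloring. -/
noncomputable def minNonColorable (n r : ℕ) : ℕ :=
  sInf {N : ℕ | ∃ E : Finset (Finset ℕ), (∀ e ∈ E, e.card = n) ∧ E.card = N ∧
    ¬ ∃ c : ℕ → Fin r, ∀ e ∈ E, ∃ u ∈ e, ∃ v ∈ e, c u ≠ c v}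

/-- The vertex lists `v₀, w₁, v₁, …, wₖ, vₖ` starting at `v` in which each `{vᵢ₋₁, wᵢ, vᵢ}` is
an edge of `E` that avoids `X` and all earlier entries of the list. -/
def chains (E : Finset (Finset ℕ)) : ℕ → ℕ → Finset ℕ → Finset (List ℕ)
  | 0, v, _ => {[v]}
  | k + 1, v, X =>
    {e ∈ E | v ∈ e ∧ Disjoint e X}.biUnion fun e =>
      (e.erase v).offDiag.biUnion fun p =>
        (chains E k p.2 (insert v (insert p.1 X))).image fun l => v :: p.1 :: l

/-- The number of edges of `E` disjoint from `X`. -/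
def avoidCount (E : Finset (Finset ℕ)) (X : Finset ℕ) : ℕ := {e ∈ E | Disjoint e X}.card

theorem mem_chains_succ {E : Finset (Finset ℕ)} {k v : ℕ} {X : Finset ℕ} {l : List ℕ} :
    l ∈ chains E (k + 1) v X ↔ ∃ e ∈ E, v ∈ e ∧ Disjoint e X ∧ ∃ w u, w ∈ e ∧ u ∈ e ∧ w ≠ v ∧
      u ≠ v ∧ w ≠ u ∧ ∃ l' ∈ chains E k u (insert v (insert w X)), l = v :: w :: l' := by
  simp only [chains, Finset.mem_biUnion, Finset.mem_filter, Finset.mem_offDiag, Finset.mem_erase,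
    Finset.mem_image, Prod.exists]
  constructor
  · rintro ⟨e, ⟨he, hv, hX⟩, w, u, ⟨⟨hwv, hw⟩, ⟨huv, hu⟩, hwu⟩, l', hl', rfl⟩
    exact ⟨e, he, hv, hX, w, u, hw, hu, hwv, huv, hwu, l', hl', rfl⟩
  · rintro ⟨e, he, hv, hX, w, u, hw, hu, hwv, huv, hwu, l', hl', rfl⟩
    exact ⟨e, ⟨he, hv, hX⟩, w, u, ⟨⟨hwv, hw⟩, ⟨huv, hu⟩, hwu⟩, l', hl', rfl⟩

theorem length_of_mem_chains {E : Finset (Finset ℕ)} {k v : ℕ} {X : Finset ℕ} {l : List ℕ}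
    (hl : l ∈ chains E k v X) : l.length = 2 * k + 1 := by
  induction k generalizing v X l with
  | zero => simp_all [chains]
  | succ k ih =>
    obtain ⟨e, -, -, -, w, u, -, -, -, -, -, l', hl', rfl⟩ := mem_chains_succ.1 hl
    simp only [List.length_cons, ih hl']
    ring

theorem subset_of_mem_chains {E : Finset (Finset ℕ)} {S : Finset ℕ} (hS : ∀ e ∈ E, e ⊆ S)
    {k v : ℕ} {X : Finset ℕ} {l : List ℕ} (hv : v ∈ S) (hl : l ∈ chains E k v X) :
    ∀ x ∈ l, x ∈ S := by
  induction k generalizing v X l with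
  | zero => simp_all [chains]
  | succ k ih =>
    obtain ⟨e, he, -, -, w, u, hw, hu, -, -, -, l', hl', rfl⟩ := mem_chains_succ.1 hl
    intro x hx
    rcases List.mem_cons.1 hx with rfl | hx
    · exact hv
    rcases List.mem_cons.1 hx with rfl | hx
    · exact hS e he hw
    · exact ih (hS e he hu) hl' x hx

theorem head_mem_of_mem_chains {E : Finset (Finset ℕ)} {k v : ℕ} {X : Finset ℕ} {l : List ℕ}
    (hl : l ∈ chains E k v X) : v ∈ l := by
  cases k with
  | zero => simp_all [chains]
  | succ k =>
    obtain ⟨e, -, -, -, w, u, -, -, -, -, -, l', -, rfl⟩ := mem_chains_succ.1 hl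
    simp

theorem mem_chains_union {E : Finset (Finset ℕ)} {k v : ℕ} {X Y : Finset ℕ}
    {l : List ℕ} (hE : ∀ e ∈ E, e.card = 3) (hl : l ∈ chains E k v X)
    (hY : ∀ x ∈ l, x ∉ Y) : l ∈ chains E k v (Y ∪ X) := by
  induction k generalizing v X l with
  | zero => simp_all [chains]
  | succ k ih =>
    obtain ⟨e, he, hv, hX, w, u, hw, hu, hwv, huv, hwu, l', hl', rfl⟩ := mem_chains_succ.1 hl
    have heq : ({v, w, u} : Finset ℕ) = e := by
      apply Finset.eq_of_subset_of_card_le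
      · intro x hx
        simp only [Finset.mem_insert, Finset.mem_singleton] at hx
        rcases hx with rfl | rfl | rfl <;> assumption
      · rw [hE e he, Finset.card_eq_three.2 ⟨v, w, u, hwv.symm, huv.symm, hwu, rfl⟩]
    refine mem_chains_succ.2 ⟨e, he, hv, ?_, w, u, hw, hu, hwv, huv, hwu, l', ?_, rfl⟩
    · rw [Finset.disjoint_union_right]
      refine ⟨?_, hX⟩
      rw [Finset.disjoint_left, ← heq]
      intro x hx
      apply hY
      simp only [Finset.mem_insert, Finset.mem_singleton] at hx
      rcases hx with rfl | rfl | rfl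
      · simp
      · simp
      · simp [head_mem_of_mem_chains hl']
    · have := ih hl' fun x hx => hY x (by simp [hx])
      rwa [Finset.union_insert, Finset.union_insert] at this

/-- If no chain of `r` edges is increasing for `ρ`, then colouring each vertex by the length of
the longest increasing chain starting there is proper. -/
theorem exists_coloring_of_no_chain {E : Finset (Finset ℕ)} (hE : ∀ e ∈ E, e.card = 3) {r : ℕ}
    {ρ : ℕ → ℕ} (hρ : Function.Injective ρ)
    (h : ∀ v, ∀ l ∈ chains E r v ∅, ¬ l.Pairwise fun x y => ρ x < ρ y) :
    ∃ c : ℕ → Fin r, ∀ e ∈ E, ∃ u ∈ e, ∃ v ∈ e, c u ≠ c v := by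
  classical
  let P : ℕ → ℕ → Prop := fun v k => ∃ l ∈ chains E k v ∅, l.Pairwise fun x y => ρ x < ρ y
  have hP0 : ∀ v, P v 0 := fun v => ⟨[v], by simp [chains], by simp⟩
  let c : ℕ → ℕ := fun v => Nat.findGreatest (P v) r
  have hPc : ∀ v, P v (c v) := fun v => Nat.findGreatest_spec (Nat.zero_le r) (hP0 v)
  have hc : ∀ v, c v < r := fun v => by
    refine lt_of_le_of_ne (Nat.findGreatest_le r) fun heq => ?_
    obtain ⟨l, hl, hl'⟩ := hPc v
    rw [heq] at hl
    exact h v l hl hl'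
  refine ⟨fun v => ⟨c v, hc v⟩, fun e he => ?_⟩
  suffices H : ∀ x ∈ e, ∀ y ∈ e, ∀ z ∈ e, ρ x < ρ y → ρ y < ρ z → c x ≠ c z by
    obtain ⟨x, y, z, hxy, hxz, hyz, rfl⟩ := Finset.card_eq_three.1 (hE e he)
    have h1 : ρ x ≠ ρ y := hρ.ne hxy
    have h2 : ρ x ≠ ρ z := hρ.ne hxz
    have h3 : ρ y ≠ ρ z := hρ.ne hyz
    by_contra! hcon
    have hcc : ∀ u ∈ ({x, y, z} : Finset ℕ), ∀ v ∈ ({x, y, z} : Finset ℕ), c u = c v :=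
      fun u hu v hv => congrArg Fin.val (hcon u hu v hv)
    have key : ∀ u ∈ ({x, y, z} : Finset ℕ), ∀ v ∈ ({x, y, z} : Finset ℕ),
        ∀ w ∈ ({x, y, z} : Finset ℕ), ¬ (ρ u < ρ v ∧ ρ v < ρ w) :=
      fun u hu v hv w hw hh => H u hu v hv w hw hh.1 hh.2 (hcc u hu w hw)
    have hx : x ∈ ({x, y, z} : Finset ℕ) := by simp
    have hy : y ∈ ({x, y, z} : Finset ℕ) := by simp
    have hz : z ∈ ({x, y, z} : Finset ℕ) := by simp
    have k1 := key x hx y hy z hz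
    have k2 := key x hx z hz y hy
    have k3 := key y hy x hx z hz
    have k4 := key y hy z hz x hx
    have k5 := key z hz x hx y hy
    have k6 := key z hz y hy x hx
    omega
  intro x hx y hy z hz hxy hyz
  obtain ⟨l, hl, hs⟩ := hPc z
  have hlt : ∀ t ∈ l, ρ y < ρ t := by
    intro t ht
    refine hyz.trans_le ?_
    have hhead : ∃ l', l = z :: l' := by
      cases hk : c z with
      | zero => rw [hk] at hl; exact ⟨[], by simpa [chains] using hl⟩
      | succ k =>
        rw [hk] at hl
        obtain ⟨-, -, -, -, w, -, -, -, -, -, -, l', -, rfl⟩ := mem_chains_succ.1 hl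
        exact ⟨_, rfl⟩
    obtain ⟨l', rfl⟩ := hhead
    rcases List.mem_cons.1 ht with rfl | ht
    · exact le_rfl
    · exact ((List.pairwise_cons.1 hs).1 t ht).le
  have hne : ∀ {s t : ℕ}, ρ s < ρ t → s ≠ t := fun hh he => by simp [he] at hh
  have hPx : P x (c z + 1) := by
    refine ⟨x :: y :: l, mem_chains_succ.2 ⟨e, he, hx, by simp, y, z, hy, hz, (hne hxy).symm,
      (hne (hxy.trans hyz)).symm, hne hyz, l, ?_, rfl⟩, ?_⟩
    · have := mem_chains_union (Y := {x, y}) hE hl (fun t ht => by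
        have := hlt t ht
        simp only [Finset.mem_insert, Finset.mem_singleton, not_or]
        exact ⟨(hne (hxy.trans this)).symm, (hne this).symm⟩)
      simpa using this
    · refine List.pairwise_cons.2 ⟨fun t ht => ?_, List.pairwise_cons.2 ⟨hlt, hs⟩⟩
      rcases List.mem_cons.1 ht with rfl | ht
      · exact hxy
      · exact hxy.trans (hlt t ht)
  have : c z + 1 ≤ c x := Nat.le_findGreatest (hc z) hPx
  omega

theorem mul_div_pow_le {a b : ℝ} (ha : 0 ≤ a) (hb : 0 ≤ b) (k : ℕ) :
    a * (b / k) ^ k ≤ ((a + b) / (k + 1 : ℕ)) ^ (k + 1) := by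
  rcases Nat.eq_zero_or_pos k with rfl | hk
  · simpa using hb
  have hk' : (0 : ℝ) < k := by exact_mod_cast hk
  rcases hb.eq_or_lt with rfl | hb
  · rw [zero_div, zero_pow hk.ne', mul_zero]
    positivity
  have hy : 0 < b / k := by positivity
  have hm : 0 ≤ (a + b) / (k + 1 : ℕ) / (b / k) := by positivity
  have h := one_add_mul_sub_le_pow (by linarith : -1 ≤ (a + b) / (k + 1 : ℕ) / (b / k)) (k + 1)
  rw [div_pow, le_div_iff₀ (by positivity)] at h
  refine le_trans (le_of_eq ?_) h
  rw [pow_succ]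
  push_cast
  field_simp
  ring

theorem avoidCount_supermodular (E : Finset (Finset ℕ)) (X : Finset ℕ) (w u : ℕ) :
    avoidCount E (insert w X) + avoidCount E (insert u X) ≤
      avoidCount E X + avoidCount E (insert w (insert u X)) := by
  unfold avoidCount
  rw [← Finset.card_union_add_card_inter]
  refine add_le_add (Finset.card_le_card ?_) (Finset.card_le_card ?_)
  · intro e
    simp only [Finset.mem_union, Finset.mem_filter, Finset.disjoint_insert_right]
    tauto
  · intro e
    simp only [Finset.mem_inter, Finset.mem_filter, Finset.disjoint_insert_right]
    tauto

theorem avoidCount_insert (E : Finset (Finset ℕ)) (X : Finset ℕ) (v : ℕ) :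
    {e ∈ E | v ∈ e ∧ Disjoint e X}.card + avoidCount E (insert v X) = avoidCount E X := by
  unfold avoidCount
  rw [← Finset.card_filter_add_card_filter_not (s := {e ∈ E | Disjoint e X}) (fun e => v ∈ e),
    Finset.filter_filter, Finset.filter_filter]
  congr 2
  · ext e; simp only [Finset.mem_filter]; tauto
  · ext e; simp only [Finset.mem_filter, Finset.disjoint_insert_right]; tauto

theorem card_chains_succ_le {E : Finset (Finset ℕ)} (hE : ∀ e ∈ E, e.card = 3) (k v : ℕ)
    (X : Finset ℕ) :
    ((chains E (k + 1) v X).card : ℝ) ≤ 2 * ((avoidCount E X : ℝ) - avoidCount E (insert v X)) *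
      ((avoidCount E (insert v X) : ℝ) / k) ^ k := by
  have hsum : ∀ (k v : ℕ) (X : Finset ℕ), (∀ e ∈ {e ∈ E | v ∈ e ∧ Disjoint e X},
      ((∑ p ∈ (e.erase v).offDiag, (chains E k p.2 (insert v (insert p.1 X))).card : ℕ) : ℝ) ≤
        2 * ((avoidCount E (insert v X) : ℝ) / k) ^ k) →
      ((chains E (k + 1) v X).card : ℝ) ≤
        2 * ((avoidCount E X : ℝ) - avoidCount E (insert v X)) *
          ((avoidCount E (insert v X) : ℝ) / k) ^ k := by
    intro k v X H
    have hcard : ((chains E (k + 1) v X).card : ℝ) ≤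
        ((∑ e ∈ {e ∈ E | v ∈ e ∧ Disjoint e X}, ∑ p ∈ (e.erase v).offDiag,
          (chains E k p.2 (insert v (insert p.1 X))).card : ℕ) : ℝ) := by
      rw [chains]
      exact_mod_cast Finset.card_biUnion_le.trans <| Finset.sum_le_sum fun e _ =>
        Finset.card_biUnion_le.trans <| Finset.sum_le_sum fun p _ => Finset.card_image_le
    refine hcard.trans ?_
    rw [Nat.cast_sum]
    refine (Finset.sum_le_sum H).trans ?_
    rw [Finset.sum_const, nsmul_eq_mul, ← avoidCount_insert E X v]
    push_cast
    apply le_of_eq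
    ring
  induction k generalizing v X with
  | zero =>
    refine hsum _ _ _ fun e he => ?_
    simp only [Finset.mem_filter] at he
    have : (e.erase v).card = 2 := by rw [Finset.card_erase_of_mem he.2.1, hE e he.1]
    simp [chains, Finset.offDiag_card, this]
  | succ k ih =>
    refine hsum _ _ _ fun e he => ?_
    simp only [Finset.mem_filter] at he
    have hcard : (e.erase v).card = 2 := by rw [Finset.card_erase_of_mem he.2.1, hE e he.1]
    obtain ⟨a, b, hab, heq⟩ := Finset.card_eq_two.1 hcard
    have hoff : ({a, b} : Finset ℕ).offDiag = {(a, b), (b, a)} := by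
      ext ⟨x, y⟩
      simp only [Finset.mem_offDiag, Finset.mem_insert, Finset.mem_singleton, Prod.mk.injEq]
      grind
    rw [heq, hoff, Finset.sum_pair (by simp [hab])]
    push_cast
    have h1 := ih b (insert v (insert a X))
    have h2 := ih a (insert v (insert b X))
    rw [Finset.insert_comm v a, Finset.insert_comm b a] at h1
    rw [Finset.insert_comm v b] at h2
    rw [Finset.insert_comm v a, Finset.insert_comm v b]
    set Y := insert v X
    have hsup : (avoidCount E (insert a Y) : ℝ) + avoidCount E (insert b Y) ≤
        avoidCount E Y + avoidCount E (insert a (insert b Y)) := by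
      exact_mod_cast avoidCount_supermodular E Y a b
    have hle : (avoidCount E (insert a (insert b Y)) : ℝ) ≤ avoidCount E Y := by
      have := avoidCount_insert E Y b
      have := avoidCount_insert E (insert b Y) a
      exact_mod_cast (by omega : avoidCount E (insert a (insert b Y)) ≤ avoidCount E Y)
    set m : ℝ := (avoidCount E (insert a (insert b Y)) : ℝ)
    have hm : 0 ≤ m := Nat.cast_nonneg _
    have hamgm := mul_div_pow_le (sub_nonneg.2 hle) hm k
    rw [sub_add_cancel, Nat.cast_succ] at hamgm
    have hpow : 0 ≤ (m / k) ^ k := by positivity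
    have := mul_le_mul_of_nonneg_right hsup hpow
    linarith

theorem card_chains_le {E : Finset (Finset ℕ)} (hE : ∀ e ∈ E, e.card = 3) {r : ℕ} (hr : 0 < r)
    (v : ℕ) : ((chains E r v ∅).card : ℝ) ≤ 2 * ((E.card : ℝ) / r) ^ r := by
  obtain ⟨k, rfl⟩ := Nat.exists_eq_succ_of_ne_zero hr.ne'
  refine (card_chains_succ_le hE k v ∅).trans ?_
  have h0 : avoidCount E ∅ = E.card := by simp [avoidCount]
  have hle : (avoidCount E {v} : ℝ) ≤ E.card := by
    exact_mod_cast Finset.card_filter_le _ _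
  have h := mul_div_pow_le (sub_nonneg.2 hle) (Nat.cast_nonneg (avoidCount E {v})) k
  rw [sub_add_cancel] at h
  rw [h0, insert_empty_eq, mul_assoc]
  exact mul_le_mul_of_nonneg_left h (by norm_num)

/-- At most a fraction `1 / m!` of all permutations make a given sequence of `m` points
increasing. -/
theorem card_strictMono_comp_mul_factorial_le {α : Type*} [Fintype α] [DecidableEq α]
    [LinearOrder α] {m : ℕ} (a : Fin m → α) :
    {σ : Equiv.Perm α | StrictMono fun i => σ (a i)}.ncard * m.factorial ≤
      (Fintype.card α).factorial := by
  classical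
  set T := {σ : Equiv.Perm α | StrictMono fun i => σ (a i)}
  rcases T.eq_empty_or_nonempty with h | ⟨σ₀, hσ₀⟩
  · simp [h]
  have ha : Function.Injective a := fun i j hij =>
    hσ₀.injective (show σ₀ (a i) = σ₀ (a j) by rw [hij])
  let f : Fin m ↪ α := ⟨a, ha⟩
  let F : T × Equiv.Perm (Fin m) → Equiv.Perm α := fun p => p.1.1 * p.2.viaFintypeEmbedding f
  have hF : ∀ p i, F p (a i) = p.1.1 (a (p.2 i)) := fun p i => by
    have := Equiv.Perm.viaFintypeEmbedding_apply_image p.2 f i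
    exact congrArg p.1.1 this
  have hinj : Function.Injective F := by
    rintro ⟨⟨σ, hσ⟩, π⟩ ⟨⟨τ, hτ⟩, π'⟩ h
    have hcomp : ∀ i, σ (a (π i)) = τ (a (π' i)) := fun i => by
      rw [← hF ⟨⟨σ, hσ⟩, π⟩, h, hF]
    have hrange : (fun i => σ (a i)) = fun i => τ (a i) := by
      refine (StrictMono.range_inj hσ hτ).1 ?_
      rw [← π.surjective.range_comp, ← π'.surjective.range_comp (fun i => τ (a i))]
      exact congrArg Set.range (funext hcomp)
    have hπ : π = π' := by
      ext i : 1
      apply hσ.injective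
      change σ (a (π i)) = σ (a (π' i))
      rw [hcomp]
      exact (congrFun hrange _).symm
    subst hπ
    have : σ = τ := mul_right_cancel h
    subst this
    rfl
  have := Nat.card_le_card_of_injective F hinj
  rwa [Nat.card_prod, Nat.card_perm, Nat.card_perm, Nat.card_fin, Nat.card_coe_set_eq,
    Nat.card_eq_fintype_card] at this

/-- A 3-uniform hypergraph without a proper `r`-coloring has an increasing chain of `r` edges for
every ordering of its vertices; double counting bounds its number of edges. -/
theorem factorial_le_of_not_colorable {E : Finset (Finset ℕ)} (hE : ∀ e ∈ E, e.card = 3) {r : ℕ}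
    (hr : 0 < r) (h : ¬ ∃ c : ℕ → Fin r, ∀ e ∈ E, ∃ u ∈ e, ∃ v ∈ e, c u ≠ c v) :
    ((2 * r + 1).factorial : ℝ) ≤ 6 * E.card * ((E.card : ℝ) / r) ^ r := by
  classical
  set S := E.biUnion id with hS
  have hES : ∀ e ∈ E, e ⊆ S := fun e he => Finset.subset_biUnion_of_mem id he
  have hScard : S.card ≤ E.card * 3 :=
    Finset.card_biUnion_le_card_mul _ _ _ fun e he => (hE e he).le
  let T : List ℕ → Finset (Equiv.Perm S) := fun l =>
    {σ | l.Pairwise fun x y => Equiv.Perm.ofSubtype σ x < Equiv.Perm.ofSubtype σ y}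
  have hT : ∀ v ∈ S, ∀ l ∈ chains E r v ∅,
      (T l).card * (2 * r + 1).factorial ≤ S.card.factorial := by
    intro v hv l hl
    have hlS := subset_of_mem_chains hES hv hl
    have := card_strictMono_comp_mul_factorial_le (α := S)
      fun i : Fin l.length => ⟨l.get i, hlS _ (l.get_mem i)⟩
    rw [Fintype.card_coe] at this
    rw [← length_of_mem_chains hl]
    refine le_trans (le_of_eq ?_) this
    rw [← Set.ncard_coe_finset]
    congr 2
    ext σ
    simp only [T, Finset.coe_filter, Finset.mem_univ, true_and, Set.mem_ofPred_eq,
      List.pairwise_iff_get, StrictMono]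
    refine forall_congr' fun i => forall_congr' fun j => imp_congr_right fun _ => ?_
    rw [Equiv.Perm.ofSubtype_apply_of_mem σ (hlS _ (l.get_mem i)),
      Equiv.Perm.ofSubtype_apply_of_mem σ (hlS _ (l.get_mem j)), Subtype.coe_lt_coe]
  have hcover : (Finset.univ : Finset (Equiv.Perm S)) ⊆
      S.biUnion fun v => (chains E r v ∅).biUnion T := by
    intro σ _
    by_contra hσ
    refine h (exists_coloring_of_no_chain hE (Equiv.Perm.ofSubtype σ).injective ?_)
    intro v l hl hs
    have hv : v ∈ S := by
      obtain ⟨k, rfl⟩ := Nat.exists_eq_succ_of_ne_zero hr.ne'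
      obtain ⟨e, he, hv, -⟩ := mem_chains_succ.1 hl
      exact hES e he hv
    refine hσ (Finset.mem_biUnion.2 ⟨v, hv, Finset.mem_biUnion.2 ⟨l, hl, ?_⟩⟩)
    simpa [T] using hs
  have hcount : (2 * r + 1).factorial ≤ ∑ v ∈ S, (chains E r v ∅).card := by
    refine Nat.le_of_mul_le_mul_left ?_ S.card.factorial_pos
    calc S.card.factorial * (2 * r + 1).factorial
        = (Finset.univ : Finset (Equiv.Perm S)).card * (2 * r + 1).factorial := by
          rw [Finset.card_univ, Fintype.card_perm, Fintype.card_coe]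
      _ ≤ (∑ v ∈ S, ∑ l ∈ chains E r v ∅, (T l).card) * (2 * r + 1).factorial :=
          Nat.mul_le_mul_right _ <| (Finset.card_le_card hcover).trans <|
            Finset.card_biUnion_le.trans <| Finset.sum_le_sum fun v _ => Finset.card_biUnion_le
      _ ≤ ∑ v ∈ S, ∑ l ∈ chains E r v ∅, S.card.factorial := by
          simp only [Finset.sum_mul]
          exact Finset.sum_le_sum fun v hv => Finset.sum_le_sum fun l hl => hT v hv l hl
      _ = S.card.factorial * ∑ v ∈ S, (chains E r v ∅).card := by
          simp only [Finset.sum_const, smul_eq_mul, Finset.mul_sum, mul_comm]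
  calc ((2 * r + 1).factorial : ℝ) ≤ ∑ v ∈ S, ((chains E r v ∅).card : ℝ) := by
        exact_mod_cast hcount
    _ ≤ ∑ _v ∈ S, 2 * ((E.card : ℝ) / r) ^ r := Finset.sum_le_sum fun v _ => card_chains_le hE hr v
    _ = S.card * (2 * ((E.card : ℝ) / r) ^ r) := by rw [Finset.sum_const, nsmul_eq_mul]
    _ ≤ (E.card * 3) * (2 * ((E.card : ℝ) / r) ^ r) := by
        gcongr
        exact_mod_cast hScard
    _ = 6 * E.card * ((E.card : ℝ) / r) ^ r := by ring

theorem exists_not_colorable (r : ℕ) :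
    ∃ E : Finset (Finset ℕ), (∀ e ∈ E, e.card = 3) ∧ E.card = minNonColorable 3 r ∧
      ¬ ∃ c : ℕ → Fin r, ∀ e ∈ E, ∃ u ∈ e, ∃ v ∈ e, c u ≠ c v := by
  refine Nat.sInf_mem (s := {N : ℕ | ∃ E : Finset (Finset ℕ), (∀ e ∈ E, e.card = 3) ∧ E.card = N ∧
    ¬ ∃ c : ℕ → Fin r, ∀ e ∈ E, ∃ u ∈ e, ∃ v ∈ e, c u ≠ c v})
    ⟨_, (Finset.range (2 * r + 1)).powersetCard 3,
      fun e he => (Finset.mem_powersetCard.1 he).2, rfl, ?_⟩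
  rintro ⟨c, hc⟩
  obtain ⟨i, -, hi⟩ := Finset.exists_lt_card_fiber_of_mul_lt_card_of_maps_to
    (s := Finset.range (2 * r + 1)) (t := Finset.univ) (f := c) (n := 2)
    (fun _ _ => Finset.mem_univ _) (by simp; omega)
  obtain ⟨e, he, hecard⟩ := Finset.exists_subset_card_eq (Nat.succ_le_of_lt hi)
  obtain ⟨u, hu, v, hv, huv⟩ :=
    hc e (Finset.mem_powersetCard.2 ⟨he.trans (Finset.filter_subset _ _), hecard⟩)
  exact huv ((Finset.mem_filter.1 (he hu)).2.trans (Finset.mem_filter.1 (he hv)).2.symm)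

/-- main theorem. For every `ε > 0` there exists `r₀` such that for
all `r ≥ r₀`, `m(3, r) ≥ (4/e² − ε) · r³`; i.e. `liminf_{r→∞} m(3,r)/r³ ≥ 4/e²`. -/
theorem liminf_m3_ge_four_div_e_sq :
    ∀ ε : ℝ, 0 < ε → ∃ r₀ : ℕ, ∀ r : ℕ, r₀ ≤ r →
      (4 / Real.exp 1 ^ 2 - ε) * (r : ℝ) ^ 3 ≤ (minNonColorable 3 r : ℝ) := by
  intro ε hε
  set c : ℝ := 4 / Real.exp 1 ^ 2 - ε with hc
  rcases le_or_gt c 0 with hc0 | hc0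
  · exact ⟨0, fun r _ => (mul_nonpos_of_nonpos_of_nonneg hc0 (by positivity)).trans
      (Nat.cast_nonneg _)⟩
  set q : ℝ := c * Real.exp 1 ^ 2 / 4 with hq
  have hexp : 0 < Real.exp 1 := Real.exp_pos 1
  have hq0 : 0 < q := by positivity
  have hq1 : q < 1 := by
    rw [hq, div_lt_one (by norm_num), ← lt_div_iff₀ (by positivity)]
    linarith
  have hlim := (tendsto_pow_const_mul_const_pow_of_abs_lt_one 3
    (by rwa [abs_of_pos hq0] : |q| < 1)).const_mul (6 * c)
  rw [mul_zero] at hlim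
  obtain ⟨r₀, hr₀⟩ := Filter.eventually_atTop.1 (hlim.eventually (gt_mem_nhds one_pos))
  refine ⟨max r₀ 1, fun r hr => ?_⟩
  have hrpos : 0 < r := (le_max_right _ _).trans hr
  have hr' : (0 : ℝ) < r := by exact_mod_cast hrpos
  by_contra! hlt
  obtain ⟨E, hE, hcard, hnot⟩ := exists_not_colorable r
  have hfac := factorial_le_of_not_colorable hE hrpos hnot
  rw [hcard] at hfac
  have hupper : ((2 * r + 1).factorial : ℝ) ≤ 6 * (c * r ^ 3) * (c * r ^ 2) ^ r := by
    refine hfac.trans ?_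
    have : (minNonColorable 3 r : ℝ) / r ≤ c * r ^ 2 := by
      rw [div_le_iff₀ hr']
      linarith
    gcongr
  have hlower : ((2 * r : ℝ) / Real.exp 1) ^ (2 * r) ≤ (2 * r + 1).factorial := by
    have h := Real.pow_div_factorial_le_exp (2 * r : ℝ) (by positivity) (2 * r)
    rw [div_le_iff₀ (by positivity)] at h
    have hexp' : Real.exp (2 * r : ℝ) = Real.exp 1 ^ (2 * r) := by
      rw [← Real.exp_nat_mul]
      push_cast
      rw [mul_one]
    rw [div_pow, div_le_iff₀ (by positivity), mul_comm _ (Real.exp 1 ^ _), ← hexp']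
    refine h.trans ?_
    gcongr
    omega
  have hbase : c * (r : ℝ) ^ 2 = q * ((2 * r : ℝ) / Real.exp 1) ^ 2 := by
    rw [hq]
    field_simp
    ring
  have hpow : 0 < ((2 * r : ℝ) / Real.exp 1) ^ (2 * r) := by positivity
  have hone : 1 ≤ 6 * c * ((r : ℝ) ^ 3 * q ^ r) := by
    refine le_of_mul_le_mul_right ?_ hpow
    rw [one_mul]
    refine (hlower.trans hupper).trans (le_of_eq ?_)
    rw [hbase, mul_pow, ← pow_mul]
    ring
  exact absurd (hr₀ r ((le_max_left _ _).trans hr)) (not_lt.2 hone)
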